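/- Let k ≥ 2 be a fixed integer. There exists a constant c_k > 0, depending only on k, such that for every odd prime power q, every integer d ≥ 1, and every admissible symmetric polynomial f ∈ F_q[x_1,…,x_k] of total degree d, there exists an f-Diophantine set A ⊆ F_q with |A| ≥ c_k · (log q / log d̃)^{1/k}, where d̃ = max(2, d). -/

import Mathlib

open MvPolynomial

/-- Substitute: variable `0` of `f` is kept as the polynomial indeterminate `X`, and
variable `j+1` is replaced by `u j`. -/
noncomputable def substX {F : Type*} [Field F] {k : ℕ} (f : MvPolynomial (Fin k) F)
    (u : Fin (k - 1) → F) : Polynomial F :=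
  MvPolynomial.aeval (fun i : Fin k =>
    if h : (i : ℕ) = 0 then (Polynomial.X : Polynomial F)
    else Polynomial.C (u ⟨(i : ℕ) - 1, by have := i.isLt; omega⟩)) f

/-- `f` is admissible: not a constant multiple of a square, and the coefficients of `f` as
a polynomial in `x_1` have no common zero over the algebraic closure. -/
def Admissible {F : Type*} [Field F] {k : ℕ} (f : MvPolynomial (Fin k) F) : Prop :=
  (¬ ∃ (c : F) (g : MvPolynomial (Fin k) F), f = MvPolynomial.C c * g ^ 2) ∧
  ∀ v : Fin (k - 1) → AlgebraicClosure F,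
    substX (MvPolynomial.map (algebraMap F (AlgebraicClosure F)) f) v ≠ 0

/-- `A` is an `f`-Diophantine set: `f(a_1,…,a_k)` is a square in `F_q` whenever
`a_1,…,a_k` are distinct elements of `A`. -/
def IsfDiophantine {F : Type*} [Field F] {k : ℕ} (f : MvPolynomial (Fin k) F)
    (A : Finset F) : Prop :=
  ∀ a : Fin k → F, Function.Injective a → (∀ i, a i ∈ A) →
    IsSquare (MvPolynomial.eval a f)

section Stepanov
open Polynomial

lemma hasse_dvd {F : Type*} [Field F] (f : Polynomial F) (N : ℕ) :
    ∀ (l : ℕ) (k : Polynomial F), f ^ (N - l) ∣ hasseDeriv l (f ^ N * k) := by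
  induction N with
  | zero => intro l k; simp
  | succ N ih =>
    intro l k
    rw [pow_succ', mul_assoc, hasseDeriv_mul]
    apply Finset.dvd_sum
    rintro ⟨i, j⟩ hij
    rw [Finset.HasAntidiagonal.mem_antidiagonal] at hij
    simp only at hij ⊢
    rcases Nat.eq_zero_or_pos i with hi | hi
    · subst hi
      obtain rfl : j = l := by omega
      rw [hasseDeriv_zero']
      by_cases hj : j ≤ N
      · rw [show N + 1 - j = (N - j) + 1 by omega, pow_succ']
        exact mul_dvd_mul_left _ (ih j k)
      · rw [show N + 1 - j = 0 by omega]; simp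
    · exact ((pow_dvd_pow f (by omega)).trans (ih j k)).mul_left _

lemma hasse_quot {F : Type*} [Field F] (f : Polynomial F) (hf : f ≠ 0) (N l : ℕ) :
    ∃ φ : Polynomial F →ₗ[F] Polynomial F,
      ∀ k, hasseDeriv l (f ^ N * k) = f ^ (N - l) * φ k := by
  choose φ hφ using hasse_dvd f N l
  have h0 : f ^ (N - l) ≠ 0 := pow_ne_zero _ hf
  refine ⟨{ toFun := φ, map_add' := ?_, map_smul' := ?_ }, hφ⟩
  · intro a b
    apply mul_left_cancel₀ h0
    rw [← hφ, mul_add, map_add, hφ, hφ, mul_add]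
  · intro c b
    apply mul_left_cancel₀ h0
    rw [← hφ, mul_smul_comm, map_smul, hφ]
    simp

lemma hasse_quot_deg {F : Type*} [Field F] (f : Polynomial F) (hf : f ≠ 0) (N l D B : ℕ)
    (hl : l ≤ N) (hD : f.natDegree ≤ D)
    (φ : Polynomial F →ₗ[F] Polynomial F)
    (hφ : ∀ k, hasseDeriv l (f ^ N * k) = f ^ (N - l) * φ k)
    (k : Polynomial F) (hk : k ∈ degreeLT F B) (c : ℕ) (hc : B + l * D ≤ c) :
    (φ k).coeff c = 0 := by
  by_cases h0 : φ k = 0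
  · simp [h0]
  have hk0 : k ≠ 0 := by rintro rfl; simp at h0
  have h1 := natDegree_hasseDeriv_le (f ^ N * k) l
  rw [hφ, natDegree_mul (pow_ne_zero _ hf) h0, natDegree_mul (pow_ne_zero _ hf) hk0,
    natDegree_pow, natDegree_pow] at h1
  have h2 : k.natDegree < B := by
    rw [mem_degreeLT] at hk
    exact (natDegree_lt_iff_degree_lt hk0).2 hk
  apply coeff_eq_zero_of_natDegree_lt
  have h3 : N * f.natDegree = (N - l) * f.natDegree + l * f.natDegree := by
    rw [← add_mul]; congr 1; omega
  have h4 : l * f.natDegree ≤ l * D := Nat.mul_le_mul_left _ hD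
  omega

lemma low_dvd {R : Type*} [CommRing R] [IsDomain R] {J : ℕ} (P : Fin J → R) (Y : R) (hY : Y ≠ 0)
    (h : ∑ j, P j * Y ^ (j : ℕ) = 0) (j0 : Fin J) (h0 : ∀ j < j0, P j = 0) : Y ∣ P j0 := by
  rw [← Finset.add_sum_erase _ _ (Finset.mem_univ j0)] at h
  have h1 : Y ^ ((j0 : ℕ) + 1) ∣ ∑ j ∈ Finset.univ.erase j0, P j * Y ^ (j : ℕ) := by
    apply Finset.dvd_sum
    intro j hj
    rcases lt_trichotomy j j0 with hh | hh | hh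
    · simp [h0 j hh]
    · simp [hh] at hj
    · exact (pow_dvd_pow _ (by omega)).mul_left _
  have h2 : Y ^ ((j0 : ℕ) + 1) ∣ P j0 * Y ^ (j0 : ℕ) := by
    rw [eq_neg_of_add_eq_zero_left h]; exact (dvd_neg).2 h1
  rw [pow_succ', ] at h2
  exact (mul_dvd_mul_iff_right (pow_ne_zero _ hY)).1 h2

lemma sub_C_pow_card {F : Type*} [Field F] [Fintype F] (p : Polynomial F) (x : F) :
    (p - Polynomial.C x) ^ (Fintype.card F) = p ^ (Fintype.card F) - Polynomial.C x := by
  obtain ⟨n, hp, hn⟩ := FiniteField.card F (ringChar F)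
  have := Fact.mk hp
  rw [hn, sub_pow_char_pow, ← Polynomial.C_pow, ← hn, FiniteField.pow_card]

lemma step_key {F : Type*} [Field F] [Fintype F] (f k l : Polynomial F) (hf0 : f.coeff 0 ≠ 0)
    (hns : ¬ ∃ (c : F) (g : Polynomial F), f = Polynomial.C c * g ^ 2) (D B : ℕ)
    (hD : f.natDegree ≤ D) (hq : 2 * B + D ≤ Fintype.card F + 1) (hB : 1 ≤ B)
    (hk : k ∈ degreeLT F B) (hl : l ∈ degreeLT F B) (e : ℕ) (he : 2 * e + 1 = Fintype.card F)
    (h : (X : Polynomial F) ^ (Fintype.card F) ∣ k + f ^ e * l) : k = 0 ∧ l = 0 := by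
  have h1 : (X : Polynomial F) ^ (Fintype.card F) ∣ k ^ 2 * f - Polynomial.C (f.coeff 0) * l ^ 2 := by
    have h2 : (X : Polynomial F) ^ (Fintype.card F) ∣ f ^ (Fintype.card F) - Polynomial.C (f.coeff 0) := by
      rw [← sub_C_pow_card]
      apply pow_dvd_pow_of_dvd
      rw [Polynomial.X_dvd_iff]; simp
    have h3 : k ^ 2 * f - Polynomial.C (f.coeff 0) * l ^ 2 =
        (k + f ^ e * l) * ((k - f ^ e * l) * f)
          + (f ^ (Fintype.card F) - Polynomial.C (f.coeff 0)) * l ^ 2 := by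
      rw [← he]; ring
    rw [h3]
    exact dvd_add (h.mul_right _) (h2.mul_right _)
  have nd : ∀ p ∈ degreeLT F B, p.natDegree ≤ B - 1 := by
    intro p hp
    by_cases hp0 : p = 0
    · simp [hp0]
    rw [mem_degreeLT] at hp
    have := (natDegree_lt_iff_degree_lt hp0).2 hp
    omega
  have h4 : k ^ 2 * f - Polynomial.C (f.coeff 0) * l ^ 2 = 0 := by
    by_contra hne
    have h5 := natDegree_le_of_dvd h1 hne
    rw [natDegree_X_pow] at h5
    have h6 : (k ^ 2 * f - Polynomial.C (f.coeff 0) * l ^ 2).natDegree ≤ 2 * (B - 1) + D := by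
      refine (natDegree_sub_le _ _).trans (max_le ?_ ?_)
      · refine natDegree_mul_le.trans (add_le_add ?_ hD)
        exact natDegree_pow_le.trans (Nat.mul_le_mul_left _ (nd k hk))
      · refine (natDegree_C_mul_le _ _).trans ?_
        exact (natDegree_pow_le.trans (Nat.mul_le_mul_left _ (nd l hl))).trans (by omega)
    omega
  by_cases hk0 : k = 0
  · subst hk0
    refine ⟨rfl, ?_⟩
    simpa [hf0] using h4
  · exfalso
    apply hns
    have h5 : k ^ 2 * f = Polynomial.C (f.coeff 0) * l ^ 2 := sub_eq_zero.1 h4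
    have hu : IsUnit (Polynomial.C (f.coeff 0)) := Polynomial.isUnit_C.2 (isUnit_iff_ne_zero.2 hf0)
    have h6 : k ^ 2 ∣ l ^ 2 := by
      rw [← hu.dvd_mul_left, ← h5]; exact dvd_mul_right _ _
    have h7 : k ∣ l := (IsIntegrallyClosed.pow_dvd_pow_iff two_ne_zero).1 h6
    obtain ⟨w, rfl⟩ := h7
    refine ⟨f.coeff 0, w, ?_⟩
    apply mul_left_cancel₀ (pow_ne_zero 2 hk0)
    rw [h5]; ring

end Stepanov

section Stepanov2
open Polynomial

lemma step_exists {F : Type*} [Field F] (f : Polynomial F) (hf : f ≠ 0) (D M J B e : ℕ)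
    (hD : f.natDegree ≤ D) (hdim : M * (B + M * D + J) < J * (2 * B)) :
    ∃ k l : Fin J → Polynomial F, (∀ j, k j ∈ degreeLT F B) ∧ (∀ j, l j ∈ degreeLT F B) ∧
      (¬ ∀ j, k j = 0 ∧ l j = 0) ∧
      ∀ i < M, ∀ x : F, f.eval x ^ e = -1 →
        (hasseDeriv i (∑ j : Fin _, Polynomial.C (x ^ (j : ℕ)) *
          (f ^ M * k j + f ^ (M + e) * l j))).eval x = 0 := by
  choose φ hφ using fun i => hasse_quot f hf M i
  choose ψ hψ using fun i => hasse_quot f hf (M + e) i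
  let L : (Fin B → F) →ₗ[F] Polynomial F :=
    (degreeLT F B).subtype ∘ₗ (degreeLTEquiv F B).symm.toLinearMap
  have hL : ∀ v, L v ∈ degreeLT F B := fun v => ((degreeLTEquiv F B).symm v).2
  have hL0 : ∀ v, L v = 0 → v = 0 := by
    intro v hv
    have : (degreeLTEquiv F B).symm v = 0 := Subtype.ext hv
    simpa using this
  let Q : ℕ → (Fin J → (Fin B → F) × (Fin B → F)) →ₗ[F] Polynomial F := fun i =>
    { toFun := fun v => ∑ j : Fin _, Polynomial.X ^ (j : ℕ) * (φ i (L (v j).1) - ψ i (L (v j).2))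
      map_add' := by
        intro a b
        rw [← Finset.sum_add_distrib]
        refine Finset.sum_congr rfl fun j _ => ?_
        simp only [Pi.add_apply, Prod.fst_add, Prod.snd_add, map_add]
        ring
      map_smul' := by
        intro a b
        rw [RingHom.id_apply, Finset.smul_sum]
        refine Finset.sum_congr rfl fun j _ => ?_
        simp only [Pi.smul_apply, Prod.smul_fst, Prod.smul_snd, map_smul, ← smul_sub,
          mul_smul_comm] }
  let T : (Fin J → (Fin B → F) × (Fin B → F)) →ₗ[F] (Fin M → Fin (B + M * D + J) → F) :=
    LinearMap.pi fun i => LinearMap.pi fun c => (Polynomial.lcoeff F (c : ℕ)) ∘ₗ Q i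
  have hker : LinearMap.ker T ≠ ⊥ := by
    apply LinearMap.ker_ne_bot_of_finrank_lt
    simp only [Module.finrank_pi_fintype, Module.finrank_prod, Module.finrank_self,
      Finset.sum_const, Finset.card_univ, Fintype.card_fin, smul_eq_mul, mul_one]
    rw [← two_mul]; exact hdim
  obtain ⟨v, hv, hv0⟩ := Submodule.exists_mem_ne_zero_of_ne_bot hker
  rw [LinearMap.mem_ker] at hv
  have hQ : ∀ i < M, Q i v = 0 := by
    intro i hi
    ext c
    rw [Polynomial.coeff_zero]
    by_cases hc : c < B + M * D + J
    · exact congrFun (congrFun hv ⟨i, hi⟩) ⟨c, hc⟩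
    · change (∑ j : Fin _, Polynomial.X ^ (j : ℕ) * (φ i (L (v j).1) - ψ i (L (v j).2))).coeff c = 0
      rw [Polynomial.finsetSum_coeff]
      refine Finset.sum_eq_zero fun j _ => ?_
      have hj := j.2
      have h1 : i * D ≤ M * D := Nat.mul_le_mul_right _ hi.le
      rw [Polynomial.coeff_X_pow_mul', if_pos (by omega), Polynomial.coeff_sub,
        hasse_quot_deg f hf M i D B hi.le hD _ (hφ i) _ (hL _) _ (by omega),
        hasse_quot_deg f hf (M + e) i D B (by omega) hD _ (hψ i) _ (hL _) _ (by omega), sub_zero]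
  refine ⟨fun j => L (v j).1, fun j => L (v j).2, fun j => hL _, fun j => hL _, ?_, ?_⟩
  · intro h
    apply hv0
    funext j
    exact Prod.ext (hL0 _ (h j).1) (hL0 _ (h j).2)
  · intro i hi x hx
    have h1 := congrArg (Polynomial.eval x) (hQ i hi)
    change Polynomial.eval x (∑ j : Fin _, Polynomial.X ^ (j : ℕ) *
      (φ i (L (v j).1) - ψ i (L (v j).2))) = _ at h1
    rw [Polynomial.eval_finsetSum, Polynomial.eval_zero] at h1
    rw [map_sum, Polynomial.eval_finsetSum]
    rw [← mul_zero (f.eval x ^ (M - i)), ← h1, Finset.mul_sum]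
    refine Finset.sum_congr rfl fun j _ => ?_
    rw [← Polynomial.smul_eq_C_mul, map_smul, map_add, hφ, hψ]
    rw [show M + e - i = e + (M - i) by omega, pow_add]
    simp only [Polynomial.eval_smul, Polynomial.eval_add, Polynomial.eval_mul,
      Polynomial.eval_pow, hx, Polynomial.eval_X, Polynomial.eval_sub, smul_eq_mul]
    ring

lemma step_poly {F : Type*} [Field F] [Fintype F] (f : Polynomial F) (hf0 : f.coeff 0 ≠ 0)
    (hns : ¬ ∃ (c : F) (g : Polynomial F), f = Polynomial.C c * g ^ 2) (D m e : ℕ)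
    (hD : f.natDegree ≤ D) (hD1 : 1 ≤ D) (hm : 1 ≤ m)
    (hq : 8 * m ^ 2 * D + D + 2 ≤ Fintype.card F) (he : 2 * e + 1 = Fintype.card F) :
    ∃ h : Polynomial F, h ≠ 0 ∧
      h.natDegree ≤ 2 * m * D + 4 * m ^ 2 * D + D * e + Fintype.card F * m ∧
      ∀ x : F, f.eval x ^ e = -1 → (Polynomial.X - Polynomial.C x) ^ (2 * m) ∣ h := by
  have hf : f ≠ 0 := by rintro rfl; simp at hf0
  set q := Fintype.card F with hqdef
  have hdim : (2 * m) * ((4 * m ^ 2 * D + 1) + (2 * m) * D + (m + 1)) <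
      (m + 1) * (2 * (4 * m ^ 2 * D + 1)) := by
    have h1 : m ≤ m ^ 2 := by nlinarith
    have h2 : m ^ 2 ≤ m ^ 2 * D := by nlinarith
    nlinarith
  obtain ⟨k, l, hk, hl, hne, hder⟩ := step_exists f hf D (2 * m) (m + 1) (4 * m ^ 2 * D + 1) e hD hdim
  have nd : ∀ p ∈ degreeLT F (4 * m ^ 2 * D + 1), p.natDegree ≤ 4 * m ^ 2 * D := by
    intro p hp
    by_cases hp0 : p = 0
    · simp [hp0]
    rw [mem_degreeLT] at hp
    have := (natDegree_lt_iff_degree_lt hp0).2 hp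
    omega
  refine ⟨∑ j : Fin _, (f ^ (2 * m) * k j + f ^ (2 * m + e) * l j) * (Polynomial.X ^ q) ^ (j : ℕ), ?_, ?_, ?_⟩
  · intro h0
    apply hne
    have h1 : ∑ j : Fin _, (k j + f ^ e * l j) * ((Polynomial.X : Polynomial F) ^ q) ^ (j : ℕ) = 0 := by
      apply mul_left_cancel₀ (pow_ne_zero (2 * m) hf)
      rw [mul_zero, ← h0, Finset.mul_sum]
      refine Finset.sum_congr rfl fun j _ => ?_
      rw [pow_add]; ring
    have hstrong : ∀ (n : ℕ) (hn : n < m + 1), k ⟨n, hn⟩ = 0 ∧ l ⟨n, hn⟩ = 0 := by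
      intro n
      induction n using Nat.strong_induction_on with
      | _ n ih =>
        intro hn
        have h2 := low_dvd (fun j => k j + f ^ e * l j) ((Polynomial.X : Polynomial F) ^ q)
          (pow_ne_zero _ Polynomial.X_ne_zero) h1 ⟨n, hn⟩ (by
            intro j hj
            have := ih j hj j.2
            simp only [Fin.eta] at this
            simp [this.1, this.2])
        exact step_key f _ _ hf0 hns D (4 * m ^ 2 * D + 1) hD (by
          rw [← hqdef]; nlinarith) (by omega) (hk _) (hl _) e he h2
    exact fun j => hstrong j j.2
  · apply Polynomial.natDegree_sum_le_of_forall_le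
    intro j _
    refine natDegree_mul_le.trans (add_le_add ?_ ?_)
    · have hp : ∀ n : ℕ, (f ^ n).natDegree ≤ n * D := fun n =>
        natDegree_pow_le.trans (Nat.mul_le_mul_left _ hD)
      refine (natDegree_add_le _ _).trans (max_le ?_ ?_)
      · refine natDegree_mul_le.trans ((add_le_add (hp _) (nd _ (hk j))).trans ?_)
        omega
      · refine natDegree_mul_le.trans ((add_le_add (hp _) (nd _ (hl j))).trans ?_)
        rw [add_mul, mul_comm e D]
        omega
    · rw [← pow_mul]
      refine (natDegree_X_pow_le _).trans (Nat.mul_le_mul_left _ (by have := j.2; omega))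
  · intro x hx
    have hMq : 2 * m ≤ q := by nlinarith
    have h1 : (Polynomial.X - Polynomial.C x) ^ (2 * m) ∣
        ∑ j : Fin _, Polynomial.C (x ^ (j : ℕ)) *
          (f ^ (2 * m) * k j + f ^ (2 * m + e) * l j) := by
      rw [Polynomial.X_sub_C_pow_dvd_iff, ← Polynomial.taylor_apply, Polynomial.X_pow_dvd_iff]
      intro i hi
      rw [Polynomial.taylor_coeff]
      exact hder i hi x hx
    rw [← dvd_sub_left h1 (a := (Polynomial.X - Polynomial.C x) ^ (2 * m))] 
    rw [← Finset.sum_sub_distrib]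
    apply Finset.dvd_sum
    intro j _
    have h2 : (Polynomial.X - Polynomial.C x) ^ q ∣
        (Polynomial.X ^ q) ^ (j : ℕ) - Polynomial.C x ^ (j : ℕ) := by
      rw [sub_C_pow_card]
      exact sub_dvd_pow_sub_pow _ _ _
    have h3 := ((pow_dvd_pow (Polynomial.X - Polynomial.C x) hMq).trans h2).mul_left
      (f ^ (2 * m) * k j + f ^ (2 * m + e) * l j)
    rw [Polynomial.C_pow]
    convert h3 using 1
    ring

lemma step_count {F : Type*} [Field F] [Fintype F] [DecidableEq F] (f : Polynomial F)
    (hf0 : f.coeff 0 ≠ 0)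
    (hns : ¬ ∃ (c : F) (g : Polynomial F), f = Polynomial.C c * g ^ 2) (D m e : ℕ)
    (hD : f.natDegree ≤ D) (hD1 : 1 ≤ D) (hm : 1 ≤ m)
    (hq : 8 * m ^ 2 * D + D + 2 ≤ Fintype.card F) (he : 2 * e + 1 = Fintype.card F) :
    2 * m * (Finset.univ.filter fun x : F => f.eval x ^ e = -1).card ≤
      2 * m * D + 4 * m ^ 2 * D + D * e + Fintype.card F * m := by
  obtain ⟨h, h0, hdeg, hdvd⟩ := step_poly f hf0 hns D m e hD hD1 hm hq he
  refine le_trans ?_ hdeg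
  have h1 : ∏ x ∈ (Finset.univ.filter fun x : F => f.eval x ^ e = -1),
      (Polynomial.X - Polynomial.C x) ^ (2 * m) ∣ h := by
    apply Finset.prod_dvd_of_coprime
    · intro a _ b _ hab
      exact (Polynomial.pairwise_coprime_X_sub_C (Function.injective_id) hab).pow
    · intro x hx
      exact hdvd x (Finset.mem_filter.1 hx).2
  have h2 := Polynomial.natDegree_le_of_dvd h1 h0
  rw [Polynomial.natDegree_prod_of_monic _ _ (fun x _ => (Polynomial.monic_X_sub_C x).pow _)] at h2
  simp only [Polynomial.natDegree_pow, Polynomial.natDegree_X_sub_C, Finset.sum_const,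
    smul_eq_mul, mul_one] at h2
  rw [mul_comm]; exact h2

lemma step_charsum {F : Type*} [Field F] [Fintype F] [DecidableEq F] (f : Polynomial F)
    (hf0 : f.coeff 0 ≠ 0)
    (hns : ¬ ∃ (c : F) (g : Polynomial F), f = Polynomial.C c * g ^ 2) (D m : ℕ)
    (hodd : Odd (Fintype.card F))
    (hD : f.natDegree ≤ D) (hD1 : 1 ≤ D) (hm : 1 ≤ m)
    (hq : 8 * m ^ 2 * D + D + 2 ≤ Fintype.card F) :
    -(3 * D * Fintype.card F : ℤ) ≤ m * ∑ x : F, quadraticChar F (f.eval x) := by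
  obtain ⟨e, he⟩ := hodd
  have hchar : ringChar F ≠ 2 := by
    intro h
    have := FiniteField.even_card_of_char_two h
    omega
  have hf : f ≠ 0 := by rintro rfl; simp at hf0
  have hcnt := step_count f hf0 hns D m e hD hD1 hm hq he.symm
  set S := (Finset.univ.filter fun x : F => f.eval x ^ e = -1) with hS
  set Z := (Finset.univ.filter fun x : F => f.eval x = 0) with hZ
  have hZc : Z.card ≤ D := by
    refine le_trans ?_ ((Polynomial.card_roots' f).trans hD)
    refine le_trans (Finset.card_le_card (t := f.roots.toFinset) ?_) (Multiset.toFinset_card_le _)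
    intro x hx
    rw [Multiset.mem_toFinset, Polynomial.mem_roots hf]
    exact (Finset.mem_filter.1 hx).2
  have hpt : ∀ x : F, (1 : ℤ) - (if f.eval x = 0 then 1 else 0)
      - 2 * (if f.eval x ^ e = -1 then 1 else 0) ≤ quadraticChar F (f.eval x) := by
    intro x
    by_cases h0 : f.eval x = 0
    · rw [if_pos h0, h0, quadraticChar_zero]
      split_ifs <;> norm_num
    · rw [if_neg h0]
      rcases quadraticChar_dichotomy h0 with h | h
      · rw [h]; split_ifs <;> norm_num
      · have h1 := quadraticChar_eq_pow_of_char_ne_two' hchar (f.eval x)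
        rw [h, show Fintype.card F / 2 = e by omega] at h1
        rw [if_pos (by rw [← h1]; simp), h]; norm_num
  have hsum := Finset.sum_le_sum (fun x (_ : x ∈ Finset.univ) => hpt x)
  rw [Finset.sum_sub_distrib, Finset.sum_sub_distrib, ← Finset.mul_sum, Finset.sum_boole,
    Finset.sum_boole, ← hS, ← hZ] at hsum
  simp only [Finset.sum_const, Finset.card_univ, nsmul_eq_mul, mul_one] at hsum
  have h1 := mul_le_mul_of_nonneg_left hsum (show (0 : ℤ) ≤ m by positivity)
  refine le_trans ?_ h1
  zify at hcnt hZc hq he hD1 hm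
  have h2 : (m : ℤ) * Z.card ≤ m * D := mul_le_mul_of_nonneg_left hZc (by positivity)
  have h3 : (m : ℤ) * D ≤ m ^ 2 * D := by
    apply mul_le_mul_of_nonneg_right _ (by positivity); nlinarith
  have h4 : (Fintype.card F : ℤ) ≤ D * Fintype.card F := by nlinarith
  have h5 : (D : ℤ) * (2 * e + 1) = D * Fintype.card F := by rw [he]
  nlinarith
end Stepanov2

section Cert

noncomputable def sqW {R : Type*} [CommRing R] (t : R) (u : ℕ → R) : ℕ → R
  | 0 => 1
  | (n + 1) => t * (u (n + 1) - ∑ i : Fin n, sqW t u (i + 1) * sqW t u (n - i))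
termination_by n => n
decreasing_by all_goals omega

lemma sqW_zero {R : Type*} [CommRing R] (t : R) (u : ℕ → R) : sqW t u 0 = 1 := by
  rw [sqW]

lemma sqW_succ {R : Type*} [CommRing R] (t : R) (u : ℕ → R) (n : ℕ) : sqW t u (n + 1) =
    t * (u (n + 1) - ∑ i : Fin n, sqW t u (i + 1) * sqW t u (n - i)) := by
  rw [sqW]

lemma sqW_sum {R : Type*} [CommRing R] (t : R) (ht : 2 * t = 1) (u : ℕ → R) (hu : u 0 = 1)
    (j : ℕ) : ∑ p ∈ Finset.HasAntidiagonal.antidiagonal j, sqW t u p.1 * sqW t u p.2 = u j := by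
  cases j with
  | zero => simp [sqW_zero, hu]
  | succ n =>
    rw [Finset.Nat.sum_antidiagonal_eq_sum_range_succ (fun a b => sqW t u a * sqW t u b),
      Finset.sum_range_succ, Finset.sum_range_succ']
    have h1 : ∑ i ∈ Finset.range n, sqW t u (i + 1) * sqW t u (n + 1 - (i + 1)) =
        ∑ i : Fin n, sqW t u (i + 1) * sqW t u (n - i) := by
      rw [Finset.sum_range]
      refine Finset.sum_congr rfl fun i _ => ?_
      rw [show n + 1 - ((i : ℕ) + 1) = n - i by omega]
    rw [h1]
    simp only [Nat.sub_zero, Nat.sub_self, sqW_zero, one_mul, mul_one]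
    rw [sqW_succ]
    linear_combination (u (n + 1) - ∑ i : Fin n, sqW t u (i + 1) * sqW t u (n - i)) * ht

lemma sqW_deg {F : Type*} [Field F] {n : ℕ} (t : F) (u : ℕ → MvPolynomial (Fin n) F) (D : ℕ)
    (hu : ∀ j, (u j).totalDegree ≤ j * D) (j : ℕ) :
    (sqW (MvPolynomial.C t) u j).totalDegree ≤ j * D := by
  induction j using Nat.strong_induction_on with
  | _ j ih =>
    cases j with
    | zero => simp [sqW_zero]
    | succ m =>
      rw [sqW_succ]
      refine (totalDegree_mul _ _).trans ?_
      rw [totalDegree_C, zero_add]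
      refine (totalDegree_sub _ _).trans (max_le (hu _) ?_)
      refine totalDegree_finsetSum_le ?_
      intro i _
      have hi := i.2
      refine (totalDegree_mul _ _).trans ((add_le_add (ih _ (by omega)) (ih _ (by omega))).trans ?_)
      rw [← add_mul]
      exact Nat.mul_le_mul_right _ (by omega)

lemma cert {F : Type*} [Field F] (h2 : (2 : F) ≠ 0) {n : ℕ}
    (A : Polynomial (MvPolynomial (Fin n) F)) (D : ℕ) (hD1 : 1 ≤ D)
    (hdeg : A.natDegree ≤ D) (htd : ∀ i, (A.coeff i).totalDegree ≤ D) (hA0 : A.coeff 0 ≠ 0)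
    (hA : ∀ (a b : MvPolynomial (Fin n) F) (h : Polynomial (MvPolynomial (Fin n) F)), b ≠ 0 →
      Polynomial.C b ^ 2 * A ≠ Polynomial.C a * h ^ 2) :
    ∃ P : MvPolynomial (Fin n) F, P ≠ 0 ∧ P.totalDegree ≤ 2 * D ^ 2 ∧
      ∀ v : Fin n → F, eval v P ≠ 0 → (A.map (eval v)).coeff 0 ≠ 0 ∧
        ¬ ∃ (c : F) (g : Polynomial F), A.map (eval v) = Polynomial.C c * g ^ 2 := by
  set u : ℕ → MvPolynomial (Fin n) F :=
    fun j => if j = 0 then 1 else A.coeff j * A.coeff 0 ^ (j - 1) with hu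
  have hu1 : ∀ j, A.coeff 0 * u j = A.coeff j * A.coeff 0 ^ j := by
    intro j
    rcases Nat.eq_zero_or_pos j with rfl | hj
    · simp [hu]
    · simp only [hu, if_neg hj.ne']
      obtain ⟨i, rfl⟩ : ∃ i, j = i + 1 := ⟨j - 1, by omega⟩
      simp only [Nat.add_sub_cancel]
      ring
  have hud : ∀ j, (u j).totalDegree ≤ j * D := by
    intro j
    rcases Nat.eq_zero_or_pos j with rfl | hj
    · simp [hu]
    · simp only [hu, if_neg hj.ne']
      obtain ⟨i, rfl⟩ : ∃ i, j = i + 1 := ⟨j - 1, by omega⟩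
      simp only [Nat.add_sub_cancel]
      refine (totalDegree_mul _ _).trans ?_
      refine (add_le_add (htd _) ((totalDegree_pow _ _).trans (Nat.mul_le_mul_left _ (htd 0)))).trans ?_
      rw [add_mul]; omega
  set W := sqW (MvPolynomial.C (2⁻¹ : F)) u with hW
  have ht : (2 : MvPolynomial (Fin n) F) * MvPolynomial.C (2⁻¹ : F) = 1 := by
    rw [show (2 : MvPolynomial (Fin n) F) = MvPolynomial.C (2 : F) from (map_ofNat MvPolynomial.C 2).symm, ← map_mul,
      mul_inv_cancel₀ h2, map_one]
  have hWs : ∀ j, ∑ p ∈ Finset.HasAntidiagonal.antidiagonal j, W p.1 * W p.2 = u j :=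
    sqW_sum _ ht u (by simp [hu])
  have hWd : ∀ j, (W j).totalDegree ≤ j * D := sqW_deg _ u D hud
  have hex : ∃ j, D < 2 * j ∧ j ≤ D ∧ W j ≠ 0 := by
    by_contra hcon
    push Not at hcon
    set a := A.coeff 0 with ha
    set h : Polynomial (MvPolynomial (Fin n) F) :=
      ∑ j ∈ Finset.range (D + 1), Polynomial.monomial j (W j * a ^ (D - j)) with hh
    have hc : ∀ j, h.coeff j = if j ≤ D then W j * a ^ (D - j) else 0 := by
      intro j
      simp only [hh, Polynomial.finsetSum_coeff, Polynomial.coeff_monomial]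
      rw [Finset.sum_ite_eq' ]
      simp
    have hnd : h.natDegree ≤ D / 2 := by
      rw [Polynomial.natDegree_le_iff_coeff_eq_zero]
      intro j hj
      rw [hc]
      split_ifs with hjD
      · rw [hcon j (by omega) hjD, zero_mul]
      · rfl
    apply hA a (a ^ D) h (pow_ne_zero _ hA0)
    ext1 j
    rw [← Polynomial.C_pow, Polynomial.coeff_C_mul, Polynomial.coeff_C_mul]
    by_cases hj : j ≤ D
    · rw [sq h, Polynomial.coeff_mul]
      have h3 : ∑ p ∈ Finset.HasAntidiagonal.antidiagonal j, h.coeff p.1 * h.coeff p.2 =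
          a ^ (2 * D - j) * u j := by
        rw [← hWs, Finset.mul_sum]
        refine Finset.sum_congr rfl fun p hp => ?_
        rw [Finset.HasAntidiagonal.mem_antidiagonal] at hp
        rw [hc, hc, if_pos (by omega), if_pos (by omega),
          show 2 * D - j = (D - p.1) + (D - p.2) by omega, pow_add]
        ring
      rw [h3]
      have h4 : (a ^ D) ^ 2 = a ^ (2 * D - j) * a ^ j := by
        rw [← pow_add, ← pow_mul]; congr 1; omega
      rw [h4]
      linear_combination (-a ^ (2 * D - j)) * hu1 j
    · rw [Polynomial.coeff_eq_zero_of_natDegree_lt (lt_of_le_of_lt hdeg (by omega)),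
        Polynomial.coeff_eq_zero_of_natDegree_lt (p := h ^ 2), mul_zero, mul_zero]
      refine lt_of_le_of_lt (Polynomial.natDegree_pow_le.trans (Nat.mul_le_mul_left _ hnd)) ?_
      omega
  obtain ⟨j, hj1, hj2, hj3⟩ := hex
  refine ⟨A.coeff 0 * W j, mul_ne_zero hA0 hj3, ?_, ?_⟩
  · refine (totalDegree_mul _ _).trans ((add_le_add (htd 0) (hWd j)).trans ?_)
    have : j * D ≤ D * D := Nat.mul_le_mul_right _ hj2
    nlinarith
  · intro v hv
    rw [map_mul] at hv
    have ha0 : eval v (A.coeff 0) ≠ 0 := left_ne_zero_of_mul hv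
    have hw0 : eval v (W j) ≠ 0 := right_ne_zero_of_mul hv
    refine ⟨by rwa [Polynomial.coeff_map], ?_⟩
    rintro ⟨c, g, hg⟩
    set a := eval v (A.coeff 0) with ha
    set G : Polynomial F := g.comp (Polynomial.C a * Polynomial.X) with hG
    set Wv : PowerSeries F := PowerSeries.mk fun i => eval v (W i) with hWv
    have e1 : ∀ i, (Polynomial.C c * G ^ 2).coeff i = eval v (A.coeff i) * a ^ i := by
      intro i
      have : Polynomial.C c * G ^ 2 = (A.map (eval v)).comp (Polynomial.C a * Polynomial.X) := by
        rw [hg]; simp [hG]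
      rw [this, Polynomial.comp_C_mul_X_coeff, Polynomial.coeff_map]
    have e2 : PowerSeries.C a * Wv ^ 2 = ((Polynomial.C c * G ^ 2 : Polynomial F) : PowerSeries F) := by
      ext i
      rw [Polynomial.coeff_coe, e1, PowerSeries.coeff_C_mul, sq, PowerSeries.coeff_mul]
      have := congrArg (eval v) (hu1 i)
      rw [← hWs, map_mul, map_mul, map_sum, map_pow] at this
      rw [← this]
      simp [hWv, ha]
    have hg0 : c * g.coeff 0 ^ 2 = a := by
      have := e1 0
      simp only [pow_zero, mul_one] at this
      rw [← ha] at this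
      rw [← this, Polynomial.coeff_C_mul, Polynomial.coeff_zero_eq_eval_zero,
        Polynomial.coeff_zero_eq_eval_zero]
      simp [hG]
    have hc0 : c ≠ 0 := by rintro rfl; apply ha0; rw [← hg0]; simp
    have hgc : g.coeff 0 ≠ 0 := by intro h; apply ha0; rw [← hg0]; simp [h]
    have e3 : (PowerSeries.C (g.coeff 0) * Wv) ^ 2 = (G : PowerSeries F) ^ 2 := by
      have hcc : PowerSeries.C c ≠ (0 : PowerSeries F) := by
        simpa using hc0
      apply mul_left_cancel₀ hcc
      rw [← hg0] at e2
      rw [Polynomial.coe_mul, Polynomial.coe_C, Polynomial.coe_pow] at e2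
      rw [← e2, map_mul, map_pow]; ring
    have hGd : G.natDegree < j := by
      have h5 : G.natDegree ≤ g.natDegree := by
        refine Polynomial.natDegree_comp_le.trans ?_
        have : (Polynomial.C a * Polynomial.X : Polynomial F).natDegree ≤ 1 :=
          (Polynomial.natDegree_C_mul_le _ _).trans Polynomial.natDegree_X_le
        nlinarith
      have h6 : (A.map (eval v)).natDegree = 2 * g.natDegree := by
        rw [hg, Polynomial.natDegree_C_mul hc0, Polynomial.natDegree_pow]
      have h7 : (A.map (eval v)).natDegree ≤ A.natDegree := Polynomial.natDegree_map_le
      omega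
    have hGj : PowerSeries.coeff j (G : PowerSeries F) = 0 := by
      rw [Polynomial.coeff_coe]; exact Polynomial.coeff_eq_zero_of_natDegree_lt hGd
    have hz : g.coeff 0 * eval v (W j) = 0 := by
      have h8 : PowerSeries.coeff j (PowerSeries.C (g.coeff 0) * Wv) = g.coeff 0 * eval v (W j) := by
        rw [PowerSeries.coeff_C_mul, hWv, PowerSeries.coeff_mk]
      rw [← h8]
      rcases sq_eq_sq_iff_eq_or_eq_neg.1 e3 with h | h
      · rw [h, hGj]
      · rw [h, map_neg, hGj, neg_zero]
    exact (mul_ne_zero hgc hw0) hz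

end Cert

section MvSum

lemma bad_count {F : Type*} [Field F] [Fintype F] [DecidableEq F] {n : ℕ}
    (P : MvPolynomial (Fin n) F) (hP : P ≠ 0) (T : ℕ) (hT : P.totalDegree ≤ T) :
    (Finset.univ.filter fun v : Fin n → F => eval v P = 0).card * Fintype.card F ≤
      T * Fintype.card F ^ n := by
  have h := MvPolynomial.schwartz_zippel_totalDegree hP (Finset.univ : Finset F)
  rw [Fintype.piFinset_univ, Finset.card_univ] at h
  have hq : (0 : ℚ≥0) < Fintype.card F := by exact_mod_cast Fintype.card_pos
  rw [div_le_div_iff₀ (by positivity) hq] at h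
  have h' : (Finset.univ.filter fun v : Fin n → F => eval v P = 0).card * Fintype.card F ≤
      P.totalDegree * Fintype.card F ^ n := by exact_mod_cast h
  exact h'.trans (Nat.mul_le_mul_right _ hT)

lemma mv_charsum {F : Type*} [Field F] [Fintype F] [DecidableEq F] {n : ℕ}
    (hodd : Odd (Fintype.card F))
    (G : MvPolynomial (Fin (n + 1)) F) (D m : ℕ) (hD1 : 1 ≤ D) (hm : 1 ≤ m)
    (hG : G.totalDegree ≤ D) (hq : 8 * m ^ 2 * D + D + 2 ≤ Fintype.card F)
    (hA0 : (finSuccEquiv F n G).coeff 0 ≠ 0)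
    (hA : ∀ (a b : MvPolynomial (Fin n) F) (h : Polynomial (MvPolynomial (Fin n) F)), b ≠ 0 →
      Polynomial.C b ^ 2 * finSuccEquiv F n G ≠ Polynomial.C a * h ^ 2) :
    -(3 * D * Fintype.card F ^ (n + 1) + 2 * m * D ^ 2 * Fintype.card F ^ n : ℤ) ≤
      m * ∑ x : Fin (n + 1) → F, quadraticChar F (eval x G) := by
  have h2 : (2 : F) ≠ 0 := by
    apply Ring.two_ne_zero
    intro h
    have := FiniteField.even_card_of_char_two h
    obtain ⟨e, he⟩ := hodd
    omega
  have hG0 : G ≠ 0 := by rintro rfl; simp at hA0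
  have hdeg : (finSuccEquiv F n G).natDegree ≤ D := by
    rw [natDegree_finSuccEquiv]
    exact (degreeOf_le_totalDegree _ _).trans hG
  have htd : ∀ i, ((finSuccEquiv F n G).coeff i).totalDegree ≤ D := by
    intro i
    by_cases hi : (finSuccEquiv F n G).coeff i = 0
    · simp [hi]
    · have := totalDegree_coeff_finSuccEquiv_add_le G i hi
      omega
  obtain ⟨P, hP0, hPd, hP⟩ := cert h2 _ D hD1 hdeg htd hA0 hA
  have hbad := bad_count P hP0 _ hPd
  have hsum : ∑ x : Fin (n + 1) → F, quadraticChar F (eval x G) =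
      ∑ v : Fin n → F, ∑ y : F,
        quadraticChar F (((finSuccEquiv F n G).map (eval v)).eval y) := by
    rw [← (Fin.consEquiv (fun _ : Fin (n + 1) => F)).sum_comp, Fintype.sum_prod_type_right]
    refine Finset.sum_congr rfl fun v _ => Finset.sum_congr rfl fun y _ => ?_
    rw [← eval_eq_eval_mv_eval']
    rfl
  have hv : ∀ v : Fin n → F, -(3 * D * Fintype.card F : ℤ)
      - m * Fintype.card F * (if eval v P = 0 then 1 else 0) ≤
      m * ∑ y : F, quadraticChar F (((finSuccEquiv F n G).map (eval v)).eval y) := by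
    intro v
    split_ifs with h0
    · have h1 : -(Fintype.card F : ℤ) ≤
          ∑ y : F, quadraticChar F (((finSuccEquiv F n G).map (eval v)).eval y) := by
        have : ∑ y : F, (-1 : ℤ) ≤
          ∑ y : F, quadraticChar F (((finSuccEquiv F n G).map (eval v)).eval y) := by
          refine Finset.sum_le_sum fun y _ => ?_
          rcases (quadraticChar_isQuadratic F) (((finSuccEquiv F n G).map (eval v)).eval y)
            with h | h | h <;> rw [h] <;> norm_num
        simpa using this
      have h3 := mul_le_mul_of_nonneg_left h1 (show (0 : ℤ) ≤ m by positivity)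
      have : (0 : ℤ) ≤ 3 * D * Fintype.card F := by positivity
      linarith
    · have h1 := hP v h0
      have := step_charsum _ h1.1 h1.2 D m hodd
        ((Polynomial.natDegree_map_le).trans hdeg) hD1 hm hq
      linarith
  rw [hsum, Finset.mul_sum]
  refine le_trans ?_ (Finset.sum_le_sum fun v _ => hv v)
  rw [Finset.sum_sub_distrib, ← Finset.mul_sum, Finset.sum_boole]
  simp only [Finset.sum_const, Finset.card_univ, Fintype.card_pi, Finset.prod_const,
    Fintype.card_fin, nsmul_eq_mul]
  zify at hbad
  have h3 := mul_le_mul_of_nonneg_left hbad (show (0 : ℤ) ≤ m by positivity)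
  push_cast
  rw [pow_succ]
  linarith

end MvSum


lemma exists_zero {F : Type*} [Field F] {N : ℕ} (P : MvPolynomial (Fin N) F) (hP : ¬ IsUnit P) :
    ∃ z : Fin N → AlgebraicClosure F, aeval z P = 0 := by
  have h1 : Ideal.span {P} ≠ ⊤ := by rwa [Ne, Ideal.span_singleton_eq_top]
  obtain ⟨M, hM, hle⟩ := Ideal.exists_le_maximal _ h1
  obtain ⟨z, hz⟩ := MvPolynomial.eq_vanishingIdeal_singleton_of_isMaximal (AlgebraicClosure F) hM
  refine ⟨z, ?_⟩
  rw [← mem_vanishingIdeal_singleton_iff, ← hz]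
  exact hle (Ideal.mem_span_singleton_self P)

lemma var_of_dvd {F : Type*} [Field F] {k N : ℕ} (f : MvPolynomial (Fin k) F)
    (hs : f.IsSymmetric) (hf : Admissible f) (σ : Fin k → Fin N) (hσ : Function.Injective σ)
    (P : MvPolynomial (Fin N) F) (hP : ¬ IsUnit P) (hd : P ∣ rename σ f) (j0 : Fin k) :
    degreeOf (σ j0) P ≠ 0 := by
  classical
  intro hdeg
  have hv : σ j0 ∉ P.vars := by
    intro h
    exact (mem_vars_iff_degreeOf_ne_zero.mp h) hdeg
  obtain ⟨z, hz⟩ := exists_zero P hP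
  have h0 : ∀ t : AlgebraicClosure F, aeval (Function.update z (σ j0) t) P = 0 := by
    intro t
    rw [← hz]
    refine eval₂Hom_congr' rfl ?_ rfl
    intro i hi _
    rw [Function.update_of_ne]
    rintro rfl
    exact hv hi
  have hk : 0 < k := j0.pos
  let i0 : Fin k := ⟨0, hk⟩
  have h1 : ∀ t : AlgebraicClosure F, aeval (Function.update (z ∘ σ) j0 t) f = 0 := by
    intro t
    have : Function.update (z ∘ σ) j0 t = (Function.update z (σ j0) t) ∘ σ := by
      funext i
      by_cases h : i = j0
      · subst h; simp
      · simp [h, hσ.ne h]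
    rw [this, ← aeval_rename]
    obtain ⟨Q, hQ⟩ := hd
    rw [hQ, map_mul, h0, zero_mul]
  have h2 : ∀ t : AlgebraicClosure F,
      aeval (Function.update (z ∘ σ) j0 t ∘ Equiv.swap i0 j0) f = 0 := by
    intro t
    rw [← aeval_rename, hs, h1]
  apply hf.2 (fun j => (z ∘ σ ∘ Equiv.swap i0 j0) ⟨(j : ℕ) + 1, by have := j.isLt; omega⟩)
  apply Polynomial.funext
  intro t
  rw [Polynomial.eval_zero, ← h2 t, substX]
  rw [← Polynomial.coe_evalRingHom, ← AlgHom.coe_toRingHom, ← RingHom.comp_apply,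
    ← RingHom.comp_apply, ← AlgHom.coe_toRingHom]
  congr 1
  apply MvPolynomial.ringHom_ext
  · intro r; simp
  · intro i
    simp only [RingHom.comp_apply, map_X, AlgHom.coe_toRingHom, aeval_X,
      Polynomial.coe_evalRingHom, Function.comp]
    by_cases h : (i : ℕ) = 0
    · have : i = i0 := Fin.ext h
      subst this
      simp [i0]
    · have hne : i ≠ i0 := fun hh => h (by rw [hh])
      have : Equiv.swap i0 j0 i ≠ j0 := by
        intro hh
        apply hne
        apply (Equiv.swap i0 j0).injective
        rw [hh, Equiv.swap_apply_left]
      have h3 : (⟨(i:ℕ) - 1 + 1, by have := i.isLt; omega⟩ : Fin k) = i := Fin.ext (by simp; omega)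
      simp only [h, dite_false, Polynomial.eval_C, Function.update_of_ne this, h3]
      rfl

lemma adm_ne_zero {F : Type*} [Field F] {k : ℕ} (f : MvPolynomial (Fin k) F)
    (hf : Admissible f) : f ≠ 0 := by
  rintro rfl
  exact hf.1 ⟨0, 0, by simp⟩

lemma degreeOf_zero_of_dvd {F : Type*} [Field F] {N : ℕ} {P Q : MvPolynomial (Fin N) F} (j : Fin N)
    (hQ : Q ≠ 0) (h : P ∣ Q) (h0 : degreeOf j Q = 0) : degreeOf j P = 0 := by
  obtain ⟨R, rfl⟩ := h
  rw [degreeOf_mul_eq (left_ne_zero_of_mul hQ) (right_ne_zero_of_mul hQ)] at h0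
  omega

lemma degreeOf_rename_zero {F : Type*} [Field F] {k N : ℕ} (f : MvPolynomial (Fin k) F)
    (σ : Fin k → Fin N) (j : Fin N) (hj : j ∉ Set.range σ) : degreeOf j (rename σ f) = 0 := by
  classical
  by_contra h
  have := vars_rename σ f (mem_vars_iff_degreeOf_ne_zero.mpr h)
  rw [Finset.mem_image] at this
  obtain ⟨a, _, ha⟩ := this
  exact hj ⟨a, ha⟩

lemma relprime_of_not_mem {F : Type*} [Field F] {k l N : ℕ} (f : MvPolynomial (Fin k) F)
    (hs : f.IsSymmetric) (hf : Admissible f) (σ : Fin k → Fin N) (hσ : Function.Injective σ)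
    (g : MvPolynomial (Fin l) F) (hg : g ≠ 0) (τ : Fin l → Fin N) (hτ : Function.Injective τ)
    (j : Fin N) (h1 : j ∈ Set.range σ) (h2 : j ∉ Set.range τ) :
    IsRelPrime (rename σ f) (rename τ g) := by
  intro P hP1 hP2
  by_contra hu
  obtain ⟨j0, rfl⟩ := h1
  refine var_of_dvd f hs hf σ hσ P hu hP1 j0 ?_
  refine degreeOf_zero_of_dvd _ ?_ hP2 (degreeOf_rename_zero _ _ _ h2)
  exact fun h => hg (rename_injective τ hτ (by simpa using h))

lemma relprime_of_range_ne {F : Type*} [Field F] {k N : ℕ} (f : MvPolynomial (Fin k) F)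
    (hs : f.IsSymmetric) (hf : Admissible f) (σ τ : Fin k → Fin N) (hσ : Function.Injective σ)
    (hτ : Function.Injective τ) (hne : Set.range σ ≠ Set.range τ) :
    IsRelPrime (rename σ f) (rename τ f) := by
  have h0 := adm_ne_zero f hf
  by_cases h : Set.range σ ⊆ Set.range τ
  · have h' : ¬ Set.range τ ⊆ Set.range σ := fun h' => hne (h.antisymm h')
    obtain ⟨j, hj1, hj2⟩ := Set.not_subset.mp h'
    exact (relprime_of_not_mem f hs hf τ hτ f h0 σ hσ j hj1 hj2).symm
  · obtain ⟨j, hj1, hj2⟩ := Set.not_subset.mp h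
    exact relprime_of_not_mem f hs hf σ hσ f h0 τ hτ j hj1 hj2

lemma finSuccEquiv_rename_succ {F : Type*} [Field F] {n : ℕ} (b : MvPolynomial (Fin n) F) :
    finSuccEquiv F n (rename Fin.succ b) = Polynomial.C b := by
  have : (((finSuccEquiv F n).toAlgHom.comp (rename Fin.succ)) : MvPolynomial (Fin n) F →ₐ[F] _) =
      (Polynomial.CAlgHom : MvPolynomial (Fin n) F →ₐ[MvPolynomial (Fin n) F] _).restrictScalars F := by
    apply MvPolynomial.algHom_ext
    intro i
    simp [finSuccEquiv_X_succ]
  exact DFunLike.congr_fun this b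

lemma prod_alg {F : Type*} [Field F] {k n : ℕ} (hk : 2 ≤ k) (f : MvPolynomial (Fin k) F)
    (hs : f.IsSymmetric) (hf : Admissible f) {ι : Type*} (t : Finset ι)
    (σ : ι → Fin k → Fin (n+1)) (hσ : ∀ i ∈ t, Function.Injective (σ i))
    (hne : ∀ i ∈ t, ∀ j ∈ t, i ≠ j → Set.range (σ i) ≠ Set.range (σ j))
    (i0 : ι) (hi0 : i0 ∈ t) (h0 : 0 ∈ Set.range (σ i0)) :
    (finSuccEquiv F n (∏ i ∈ t, rename (σ i) f)).coeff 0 ≠ 0 ∧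
    ∀ (a b : MvPolynomial (Fin n) F) (h : Polynomial (MvPolynomial (Fin n) F)), b ≠ 0 →
      Polynomial.C b ^ 2 * finSuccEquiv F n (∏ i ∈ t, rename (σ i) f) ≠ Polynomial.C a * h ^ 2 := by
  classical
  have hf0 := adm_ne_zero f hf
  constructor
  · intro hc
    rw [← Polynomial.X_dvd_iff] at hc
    have h1 : (X 0 : MvPolynomial (Fin (n+1)) F) ∣ ∏ i ∈ t, rename (σ i) f := by
      obtain ⟨Q, hQ⟩ := hc
      refine ⟨(finSuccEquiv F n).symm Q, ?_⟩
      apply (finSuccEquiv F n).injective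
      rw [map_mul, finSuccEquiv_X_zero, hQ, AlgEquiv.apply_symm_apply]
    have hp : Prime (X 0 : MvPolynomial (Fin (n+1)) F) := MvPolynomial.X_prime
    obtain ⟨i, hi, hd⟩ := (hp.dvd_finsetProd_iff _).mp h1
    have : ∃ j : Fin k, σ i j ≠ 0 := by
      by_contra hcon
      push Not at hcon
      have := hσ i hi ((hcon ⟨0, by omega⟩).trans (hcon ⟨1, by omega⟩).symm)
      simp at this
    obtain ⟨j, hj⟩ := this
    refine var_of_dvd f hs hf (σ i) (hσ i hi) _ hp.not_isUnit hd j ?_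
    exact degreeOf_X_of_ne hj
  · intro a b h hb heq
    have hσ0 := hσ i0 hi0
    letI : GCDMonoid (MvPolynomial (Fin (n+1)) F) := UniqueFactorizationMonoid.toGCDMonoid _
    set B := rename Fin.succ b with hB
    set A := rename Fin.succ a with hA
    set H := (finSuccEquiv F n).symm h with hH
    have e1 : B^2 * (∏ i ∈ t, rename (σ i) f) = A * H^2 := by
      apply (finSuccEquiv F n).injective
      rw [map_mul, map_mul, map_pow, map_pow, hB, hA, finSuccEquiv_rename_succ,
        finSuccEquiv_rename_succ, hH, AlgEquiv.apply_symm_apply, heq]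
    have inj : Function.Injective (rename (R := F) (Fin.succ : Fin n → Fin (n+1))) :=
      rename_injective _ (Fin.succ_injective n)
    have hB0 : B ≠ 0 := fun hh => hb (inj (by rw [← hB, hh, map_zero]))
    have hren0 : ∀ i ∈ t, rename (σ i) f ≠ 0 := fun i hi hh =>
      hf0 (rename_injective _ (hσ i hi) (by rw [hh, map_zero]))
    have ha : a ≠ 0 := by
      rintro rfl
      rw [hA, map_zero, zero_mul] at e1
      exact mul_ne_zero (pow_ne_zero _ hB0) (Finset.prod_ne_zero_iff.mpr hren0) e1
    set u := rename (σ i0) f with hu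
    have hns : (0 : Fin (n+1)) ∉ Set.range (Fin.succ : Fin n → Fin (n+1)) := by
      rintro ⟨x, hx⟩; exact Fin.succ_ne_zero x hx
    have ruA : IsRelPrime u A :=
      relprime_of_not_mem f hs hf _ hσ0 a ha _ (Fin.succ_injective n) 0 h0 hns
    have ruB : IsRelPrime u B :=
      relprime_of_not_mem f hs hf _ hσ0 b hb _ (Fin.succ_injective n) 0 h0 hns
    have ruF : IsRelPrime u (∏ i ∈ t.erase i0, rename (σ i) f) := by
      apply IsRelPrime.prod_right
      intro i hi
      rw [Finset.mem_erase] at hi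
      exact relprime_of_range_ne f hs hf _ _ hσ0 (hσ i hi.2) (hne i0 hi0 i hi.2 (Ne.symm hi.1))
    rw [← Finset.mul_prod_erase t _ hi0, ← hu] at e1
    have d1 : u ∣ H^2 := ruA.dvd_of_dvd_mul_left ⟨B^2 * ∏ i ∈ t.erase i0, rename (σ i) f, by
      rw [← e1]; ring⟩
    obtain ⟨w, hw⟩ := d1
    have e2 : B^2 * (∏ i ∈ t.erase i0, rename (σ i) f) = A * w := by
      apply mul_left_cancel₀ (hren0 i0 hi0)
      rw [← hu]
      calc _ = B^2 * (u * ∏ i ∈ t.erase i0, rename (σ i) f) := by ring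
        _ = A * (u * w) := by rw [e1, hw]
        _ = _ := by ring
    have ruw : IsRelPrime u w := by
      have : IsRelPrime u (A * w) := by
        rw [← e2]
        exact (ruB.pow_right).mul_right ruF
      exact this.of_mul_right_right
    obtain ⟨s, v, hv⟩ := exists_associated_pow_of_mul_eq_pow (gcd_isUnit_iff_isRelPrime.mpr ruw) hw.symm
    obtain ⟨c, _, hc⟩ := isUnit_iff_eq_C_of_isReduced.mp v.isUnit
    apply hf.1
    refine ⟨c, killCompl hσ0 s, ?_⟩
    rw [← killCompl_rename_app hσ0 f, ← hu, ← hv, hc, map_mul, map_pow, killCompl_C, mul_comm]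


lemma prod_charsum {F : Type*} [Field F] [Fintype F] [DecidableEq F] {k n : ℕ} (hk : 2 ≤ k)
    (hodd : Odd (Fintype.card F)) (f : MvPolynomial (Fin k) F)
    (hs : f.IsSymmetric) (hf : Admissible f) {ι : Type*} (t : Finset ι)
    (σ : ι → Fin k → Fin (n+1)) (hσ : ∀ i ∈ t, Function.Injective (σ i))
    (hne : ∀ i ∈ t, ∀ j ∈ t, i ≠ j → Set.range (σ i) ≠ Set.range (σ j))
    (ht : t.Nonempty) (D m : ℕ) (hD1 : 1 ≤ D) (hm : 1 ≤ m) (hD : t.card * f.totalDegree ≤ D)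
    (hq : 8*m^2*D + D + 2 ≤ Fintype.card F) :
    -(3*D*Fintype.card F^(n+1) + 2*m*D^2*Fintype.card F^n : ℤ) ≤
      m * ∑ x : Fin (n+1) → F, ∏ i ∈ t, quadraticChar F (eval (x ∘ σ i) f) := by
  classical
  obtain ⟨i0, hi0⟩ := ht
  let j : Fin (n+1) := σ i0 ⟨0, by omega⟩
  let π : Equiv.Perm (Fin (n+1)) := Equiv.swap j 0
  have hπ := π.injective
  have alg := prod_alg hk f hs hf t (fun i => π ∘ σ i) (fun i hi => hπ.comp (hσ i hi))
    (by
      intro i hi i' hi' hii h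
      rw [Set.range_comp, Set.range_comp] at h
      exact hne i hi i' hi' hii (hπ.image_injective h)) i0 hi0
    ⟨⟨0, by omega⟩, by simp [π, j]⟩
  have key := mv_charsum hodd (∏ i ∈ t, rename (π ∘ σ i) f) D m hD1 hm (by
    refine (totalDegree_finsetProd _ _).trans (le_trans ?_ hD)
    rw [← smul_eq_mul]
    refine Finset.sum_le_card_nsmul _ _ _ ?_
    intro i hi
    exact totalDegree_rename_le _ _) hq alg.1 alg.2
  refine key.trans (le_of_eq ?_)
  congr 1
  rw [← Equiv.sum_comp (Equiv.arrowCongr π (Equiv.refl F))]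
  refine Finset.sum_congr rfl fun x _ => ?_
  rw [map_prod, map_prod]
  refine Finset.prod_congr rfl fun i _ => ?_
  rw [eval_rename]
  congr 3
  funext a
  simp

lemma card_not_inj {F : Type*} [Fintype F] [DecidableEq F] (n : ℕ) :
    (Finset.univ.filter fun x : Fin (n+1) → F => ¬ Function.Injective x).card
      ≤ (n+1)^2 * Fintype.card F ^ n := by
  classical
  have hsub : (Finset.univ.filter fun x : Fin (n+1) → F => ¬ Function.Injective x) ⊆
      (Finset.univ : Finset (Fin (n+1) × Fin (n+1))).biUnion fun p =>
        Finset.univ.filter fun x : Fin (n+1) → F => p.1 ≠ p.2 ∧ x p.1 = x p.2 := by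
    intro x hx
    rw [Finset.mem_filter] at hx
    have := hx.2
    simp only [Function.Injective, not_forall] at this
    obtain ⟨a, b, h, hab⟩ := this
    rw [Finset.mem_biUnion]
    exact ⟨(a,b), Finset.mem_univ _, by simp [hab, h]⟩
  refine (Finset.card_le_card hsub).trans (Finset.card_biUnion_le.trans ?_)
  refine (Finset.sum_le_card_nsmul _ _ (Fintype.card F ^ n) ?_).trans ?_
  · rintro ⟨a, b⟩ _
    have : Fintype.card F ^ n = (Finset.univ : Finset (Fin n → F)).card := by simp
    rw [this]
    refine Finset.card_le_card_of_injOn (fun x => x ∘ b.succAbove) (by intro x _; simp) ?_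
    intro x hx y hy hxy
    simp only [Finset.coe_filter, Finset.mem_univ, true_and, Set.mem_ofPred_eq] at hx hy
    have h1 : ∀ c, c ≠ b → x c = y c := by
      intro c hc
      obtain ⟨e, rfl⟩ := Fin.exists_succAbove_eq hc
      exact congrFun hxy e
    funext c
    by_cases hc : c = b
    · subst hc
      rw [← hx.2, ← hy.2, h1 _ hx.1]
    · exact h1 c hc
  · simp [sq]

lemma exists_x {F : Type*} [Field F] [Fintype F] {k n : ℕ} (hk : 2 ≤ k)
    (hodd : Odd (Fintype.card F)) (f : MvPolynomial (Fin k) F)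
    (hs : f.IsSymmetric) (hf : Admissible f) (d : ℕ) (hd : 1 ≤ d) (hfd : f.totalDegree = d)
    (hq : 291 * ((n+1)^k*d)^3 * 4^((n+1)^k) ≤ Fintype.card F) :
    ∃ x : Fin (n+1) → F, Function.Injective x ∧
      ∀ σ : Fin k ↪o Fin (n+1), IsSquare (eval (x ∘ σ) f) := by
  classical
  by_contra hcon
  push Not at hcon
  letI : Fintype (Fin k ↪o Fin (n+1)) := Fintype.ofFinite _
  set M := (n+1)^k with hM
  set D := M * d with hDdef
  set m := 6 * D * 2^M with hmdef
  set q := Fintype.card F with hqdef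
  have hM1 : 1 ≤ M := Nat.one_le_pow _ _ (by omega)
  have hD1 : 1 ≤ D := Nat.mul_pos hM1 hd
  have hm1 : 1 ≤ m := Nat.succ_le_of_lt (by positivity)
  have hcard : Fintype.card (Fin k ↪o Fin (n+1)) ≤ M := by
    have := Fintype.card_le_of_injective (fun σ : Fin k ↪o Fin (n+1) => (σ : Fin k → Fin (n+1)))
      DFunLike.coe_injective
    simpa using this
  have hD3 : D ≤ D^3 * 4^M := by
    calc D = D * 1 * 1 := by ring
      _ ≤ D * (D^2) * 4^M := by gcongr <;> exact Nat.one_le_pow _ _ (by omega)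
      _ = _ := by ring
  have hq' : 8*m^2*D + D + 2 ≤ q := by
    refine le_trans ?_ hq
    have : 8*m^2*D = 288 * (D^3 * 4^M) := by
      rw [hmdef, show (4:ℕ) = 2^2 by norm_num, ← pow_mul]; ring
    rw [this]
    nlinarith
  let g : (Fin (n+1) → F) → (Fin k ↪o Fin (n+1)) → ℤ :=
    fun x σ => quadraticChar F (eval (x ∘ σ) f)
  have hg : ∀ x σ, 0 ≤ 1 + g x σ ∧ 1 + g x σ ≤ 2 := by
    intro x σ
    rcases quadraticChar_isQuadratic F (eval (x ∘ σ) f) with h | h | h <;>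
      simp only [g, h] <;> norm_num
  set S : ℤ := ∑ x : Fin (n+1) → F, ∏ σ, (1 + g x σ) with hS
  -- upper bound
  have hup : S ≤ 2^M * ((n+1)^2 * q^n : ℕ) := by
    have h1 : ∀ x : Fin (n+1) → F, ∏ σ, (1 + g x σ) ≤
        if ¬ Function.Injective x then (2:ℤ)^M else 0 := by
      intro x
      split_ifs with h
      · obtain ⟨σ, hσ⟩ := hcon x h
        apply le_of_eq
        apply Finset.prod_eq_zero (Finset.mem_univ σ)
        simp only [g, quadraticChar_neg_one_iff_not_isSquare.mpr hσ]
        norm_num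
      · calc ∏ σ, (1 + g x σ) ≤ ∏ σ : Fin k ↪o Fin (n+1), (2:ℤ) :=
            Finset.prod_le_prod (fun σ _ => (hg x σ).1) (fun σ _ => (hg x σ).2)
          _ = 2 ^ Fintype.card (Fin k ↪o Fin (n+1)) := by simp
          _ ≤ 2^M := pow_le_pow_right₀ (by norm_num) hcard
    calc S ≤ ∑ x : Fin (n+1) → F, if ¬ Function.Injective x then (2:ℤ)^M else 0 :=
          Finset.sum_le_sum fun x _ => h1 x
      _ = 2^M * ((Finset.univ.filter fun x : Fin (n+1) → F => ¬ Function.Injective x).card : ℤ) := by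
          rw [← Finset.sum_filter, Finset.sum_const, nsmul_eq_mul, mul_comm]
      _ ≤ _ := by
          gcongr
          exact card_not_inj n
  -- lower bound
  set B : ℤ := 3*D*q^(n+1) + 2*m*D^2*q^n with hB
  have hB0 : 0 ≤ B := by positivity
  have hlow : (m:ℤ) * q^(n+1) - 2^M * B ≤ m * S := by
    have e : (m:ℤ) * S = ∑ t ∈ (Finset.univ : Finset (Fin k ↪o Fin (n+1))).powerset,
        m * ∑ x : Fin (n+1) → F, ∏ σ ∈ t, g x σ := by
      rw [hS, ← Finset.mul_sum, Finset.sum_comm]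
      congr 1
      refine Finset.sum_congr rfl fun x _ => ?_
      rw [Finset.prod_one_add]
    rw [e]
    have h2 : ∀ t ∈ (Finset.univ : Finset (Fin k ↪o Fin (n+1))).powerset,
        (if t = ∅ then (m:ℤ) * q^(n+1) else 0) - B ≤ m * ∑ x : Fin (n+1) → F, ∏ σ ∈ t, g x σ := by
      intro t _
      split_ifs with h
      · subst h
        simp [← hqdef, hB0]
      · rw [zero_sub]
        refine prod_charsum hk hodd f hs hf t (fun σ => (σ : Fin k → Fin (n+1)))
          (fun σ _ => σ.injective) ?_ (Finset.nonempty_iff_ne_empty.mpr h) D m hD1 hm1 ?_ hq'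
        · intro σ _ τ _ hst hr
          exact hst (DFunLike.coe_injective ((σ.strictMono.range_inj τ.strictMono).mp hr))
        · rw [hfd, hDdef]
          exact Nat.mul_le_mul_right _ ((Finset.card_le_univ t).trans hcard)
    refine le_trans ?_ (Finset.sum_le_sum h2)
    rw [Finset.sum_sub_distrib, Finset.sum_ite_eq' _ (∅ : Finset (Fin k ↪o Fin (n+1))) (fun _ => (m:ℤ) * q^(n+1)), if_pos (by simp), Finset.sum_const, Finset.card_powerset, nsmul_eq_mul, Finset.card_univ]
    have : (2:ℤ) ^ Fintype.card (Fin k ↪o Fin (n+1)) * B ≤ 2^M * B :=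
      mul_le_mul_of_nonneg_right (pow_le_pow_right₀ (by norm_num) hcard) hB0
    push_cast
    linarith
  -- contradiction
  have hqpos : 0 < q := Fintype.card_pos
  have hN : n + 1 ≤ D := by
    calc n+1 = (n+1)^1 * 1 := by ring
      _ ≤ M * d := Nat.mul_le_mul (Nat.pow_le_pow_right (by omega) (by omega)) hd
  have h3 : (m:ℤ) * q^(n+1) ≤ 2^M * B + m * (2^M * ((n+1)^2 * q^n : ℕ)) := by
    have := mul_le_mul_of_nonneg_left hup (show (0:ℤ) ≤ m by positivity)
    linarith
  have h4 : m * q^(n+1) ≤ 2^M * (3*D*q^(n+1) + 2*m*D^2*q^n) + m * (2^M * ((n+1)^2 * q^n)) := by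
    rw [hB] at h3
    exact_mod_cast h3
  have h5 : q^n * (3 * D * 2^M * q) ≤ q^n * (3 * D * 2^M * (2 * 2^M * (2*D^2 + (n+1)^2))) := by
    rw [hmdef] at h4
    have e1 : 6 * D * 2^M * q^(n+1) = q^n * (3*D*2^M*q) + q^n * (3*D*2^M*q) := by ring
    have e2 : 2^M * (3*D*q^(n+1) + 2*(6*D*2^M)*D^2*q^n) + 6*D*2^M * (2^M * ((n+1)^2 * q^n)) =
      q^n * (3*D*2^M*q) + q^n * (3 * D * 2^M * (2 * 2^M * (2*D^2 + (n+1)^2))) := by ring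
    rw [e1, e2] at h4
    omega
  have h6 := Nat.le_of_mul_le_mul_left h5 (by positivity)
  have h7 := Nat.le_of_mul_le_mul_left h6 (by positivity)
  have h8 : 2 * 2^M * (2*D^2 + (n+1)^2) ≤ 6 * (D^3 * 4^M) := by
    calc 2 * 2^M * (2*D^2 + (n+1)^2) ≤ 2 * 4^M * (2*D^2 + D^2) := by gcongr; norm_num
      _ = 6 * (D^2 * 1 * 4^M) := by ring
      _ ≤ 6 * (D^2 * D * 4^M) := by gcongr
      _ = _ := by ring
  have h9 : 0 < D^3 * 4^M := by positivity
  have h10 : 291 * D^3 * 4^M = 291 * (D^3 * 4^M) := by ring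
  omega

lemma exists_A {F : Type*} [Field F] [Fintype F] {k n : ℕ} (hk : 2 ≤ k)
    (hodd : Odd (Fintype.card F)) (f : MvPolynomial (Fin k) F)
    (hs : f.IsSymmetric) (hf : Admissible f) (d : ℕ) (hd : 1 ≤ d) (hfd : f.totalDegree = d)
    (hq : (max 2 d)^(20 * (n+1)^k) ≤ Fintype.card F) :
    ∃ A : Finset F, IsfDiophantine f A ∧ A.card = n + 1 := by
  classical
  obtain ⟨x, hx, hsq⟩ := exists_x (n := n) hk hodd f hs hf d hd hfd (by
    refine le_trans ?_ hq
    set M := (n+1)^k with hM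
    set e := max 2 d with he
    have he2 : 2 ≤ e := le_max_left _ _
    have hde : d ≤ e := le_max_right _ _
    have hM1 : 1 ≤ M := Nat.one_le_pow _ _ (by omega)
    have h1 : M ≤ e^M := (Nat.lt_two_pow_self).le.trans (Nat.pow_le_pow_left he2 _)
    have h2 : d ≤ e^M := hde.trans (Nat.le_self_pow (by omega) e)
    have h3 : 291 ≤ e^(9*M) := by
      calc 291 ≤ 2^9 := by norm_num
        _ ≤ e^9 := Nat.pow_le_pow_left he2 _
        _ ≤ e^(9*M) := Nat.pow_le_pow_right (by omega) (by omega)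
    have h4 : 4^M ≤ e^(2*M) := by
      rw [pow_mul]; exact Nat.pow_le_pow_left (by nlinarith) _
    calc 291 * (M*d)^3 * 4^M ≤ e^(9*M) * (e^M*e^M)^3 * e^(2*M) := by gcongr
      _ = e^(17*M) := by ring
      _ ≤ e^(20*M) := Nat.pow_le_pow_right (by omega) (by omega))
  refine ⟨Finset.univ.image x, ?_, by rw [Finset.card_image_of_injective _ hx]; simp⟩
  intro a ha hA
  have : ∀ i, ∃ j, x j = a i := by
    intro i
    simpa using hA i
  choose b hb using this
  have hbi : Function.Injective b := by
    intro i j hij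
    apply ha
    rw [← hb, ← hb, hij]
  have hmono : StrictMono (b ∘ Tuple.sort b) :=
    (Tuple.monotone_sort b).strictMono_of_injective (hbi.comp (Equiv.injective _))
  have := hsq (OrderEmbedding.ofStrictMono _ hmono)
  have e : x ∘ (OrderEmbedding.ofStrictMono _ hmono) = a ∘ Tuple.sort b := by
    funext i
    simp [hb]
  rw [e, ← eval_rename, hs] at this
  exact this


theorem stmt_5 (k : ℕ) (hk : 2 ≤ k) :
    ∃ c : ℝ, 0 < c ∧
      ∀ (q : ℕ) (F : Type) [Field F] [Fintype F],
        Fintype.card F = q → Odd q →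
        ∀ d : ℕ, 1 ≤ d →
        ∀ f : MvPolynomial (Fin k) F, f.IsSymmetric → f.totalDegree = d → Admissible f →
          ∃ A : Finset F, IsfDiophantine f A ∧
            c * (Real.log q / Real.log ((max 2 d : ℕ) : ℝ)) ^ ((1 : ℝ) / k) ≤
              (A.card : ℝ) := by
  refine ⟨(1/20 : ℝ)^((1:ℝ)/k) / 2, by positivity, ?_⟩
  intro q F _ _ hcard hodd d hd f hs hfd hf
  set e := max 2 d with he
  have he2 : 2 ≤ e := le_max_left _ _
  have hloge : 0 < Real.log (e:ℝ) := Real.log_pos (by exact_mod_cast he2)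
  have hqpos : 0 < q := by rw [← hcard]; exact Fintype.card_pos
  have hlogq : 0 ≤ Real.log (q:ℝ) := Real.log_natCast_nonneg q
  set L := Real.log q / Real.log (e:ℝ) with hL
  have hL0 : 0 ≤ L := div_nonneg hlogq hloge.le
  set y := (1/20 * L)^((1:ℝ)/k) with hy
  have hy0 : 0 ≤ y := by positivity
  have hyk : y^k = 1/20 * L := by
    rw [hy, one_div (k:ℝ)]
    exact Real.rpow_inv_natCast_pow (by positivity) (by omega)
  have heq : (1/20 : ℝ)^((1:ℝ)/k) / 2 * L^((1:ℝ)/k) = y / 2 := by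
    rw [hy, Real.mul_rpow (by norm_num) hL0]; ring
  rw [heq]
  have hfl := Nat.lt_floor_add_one y
  have hfl2 := Nat.floor_le hy0
  rcases Nat.eq_zero_or_pos ⌊y⌋₊ with h0 | hpos
  · refine ⟨{0}, ?_, ?_⟩
    · intro a ha hA
      exfalso
      have h1 : a ⟨0, by omega⟩ = a ⟨1, by omega⟩ := by
        rw [Finset.mem_singleton.mp (hA _), Finset.mem_singleton.mp (hA _)]
      have := ha h1
      simp at this
    · rw [h0] at hfl
      simp at hfl ⊢
      linarith
  · obtain ⟨n, hn⟩ : ∃ n, ⌊y⌋₊ = n + 1 := ⟨⌊y⌋₊ - 1, by omega⟩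
    rw [hn] at hfl hfl2
    obtain ⟨A, hA, hAc⟩ := exists_A (n := n) hk (by rw [hcard]; exact hodd) f hs hf d hd hfd (by
      rw [hcard, ← he]
      have h1 : ((n+1 : ℕ) : ℝ)^k ≤ 1/20 * L := by
        rw [← hyk]; exact pow_le_pow_left₀ (by positivity) hfl2 k
      have h2 : (20 * ((n+1 : ℕ) : ℝ)^k) * Real.log e ≤ Real.log q := by
        rw [← le_div_iff₀ hloge]; linarith
      have h3 : Real.log ((e:ℝ)^(20 * (n+1)^k)) ≤ Real.log q := by
        rw [Real.log_pow]; push_cast at h2 ⊢; exact h2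
      have h4 := (Real.log_le_log_iff (by positivity) (by positivity)).mp h3
      exact_mod_cast h4)
    refine ⟨A, hA, ?_⟩
    rw [hAc]
    push_cast at hfl ⊢
    have : (0:ℝ) ≤ n := Nat.cast_nonneg n
    linarith
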